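/- Dual Ramsey theorem for naturally ordered finite distributive lattices: for every integer k ≥ 2 and all naturally ordered finite distributive lattices L_⊑ and K_≼ such that there exists a positive surjective {0,1}-lattice homomorphism from L onto K, there exists a naturally ordered finite distributive lattice N_◁ such that for every k-coloring χ of the set of positive surjective {0,1}-lattice homomorphisms N_◁ → K_≼ there exist a color i and a positive surjective {0,1}-lattice homomorphism w : N_◁ → L_⊑ such that χ(f ∘ w) = i for every positive surjective {0,1}-lattice homomorphism f : L_⊑ → K_≼. -/

import Mathlib

open Function

/-- An element of a lattice with least element `⊥` is join-irreducible if it is not `⊥`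
and `j = a ⊔ b` implies `j = a` or `j = b`. -/
def JoinIrred {L : Type*} [Lattice L] [OrderBot L] (j : L) : Prop :=
  j ≠ ⊥ ∧ ∀ a b : L, j = a ⊔ b → j = a ∨ j = b

/-- `latN f` is the set `N(f) = {x | ∃ y, y < x ∧ f y = f x}`. -/
def latN {L K : Type*} [Preorder L] (f : L → K) : Set L :=
  {x | ∃ y, y < x ∧ f y = f x}

open Classical in
/-- `minus x S` is `x − S`: the join of the set of join-irreducibles `j` with
`j ≤ x` and `j ∉ S` (the empty join being `⊥`). -/
noncomputable def minus {L : Type*} [Lattice L] [OrderBot L] [Fintype L]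
    (x : L) (S : Set L) : L :=
  (Finset.univ.filter fun j : L => JoinIrred j ∧ j ≤ x ∧ j ∉ S).sup id

/-- A `{0,1}`-lattice homomorphism: a map preserving `⊔`, `⊓`, `⊥` and `⊤`. -/
def IsBddLatticeHom {L K : Type*} [Lattice L] [BoundedOrder L] [Lattice K] [BoundedOrder K]
    (f : L → K) : Prop :=
  (∀ x y : L, f (x ⊔ y) = f x ⊔ f y) ∧ (∀ x y : L, f (x ⊓ y) = f x ⊓ f y) ∧
    f ⊥ = ⊥ ∧ f ⊤ = ⊤

/-- `r` is a natural linear order on the bounded lattice `L`: it is a (reflexive) linear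
order whose restriction to the join-irreducibles extends the lattice order, and which is
the antilexicographic order determined by this restriction: for distinct `x`, `y`,
`x` is strictly below `y` iff the `r`-greatest join-irreducible `j` for which exactly one
of `j ≤ x`, `j ≤ y` holds satisfies `j ≤ y`. -/
def IsNaturalOrder {L : Type*} [Lattice L] [BoundedOrder L] (r : L → L → Prop) : Prop :=
  IsLinearOrder L r ∧
  (∀ j j' : L, JoinIrred j → JoinIrred j' → j ≤ j' → r j j') ∧
  ∀ x y : L, x ≠ y →
    (r x y ↔ ∃ j : L, JoinIrred j ∧ j ≤ y ∧ ¬ j ≤ x ∧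
      ∀ j' : L, JoinIrred j' → ¬ ((j' ≤ x) ↔ (j' ≤ y)) → r j' j)

/-- A homomorphism `f : L → K` between lattices carrying linear orders `rL`, `rK`
is positive if `x − N(f) ⊑ y − N(f)` implies `f x ≼ f y`. -/
def IsPositive {L K : Type*} [Lattice L] [OrderBot L] [Fintype L]
    (rL : L → L → Prop) (rK : K → K → Prop) (f : L → K) : Prop :=
  ∀ x y : L, rL (minus x (latN f)) (minus y (latN f)) → rK (f x) (f y)

open Classical in
/-- The Birkhoff dual of a `{0,1}`-lattice homomorphism: `J(f)(y) = ⋀ {x | f x ≥ y}`. -/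
noncomputable def birkhoffDual {L K : Type*} [Lattice L] [OrderTop L] [Fintype L] [Preorder K]
    (f : L → K) (y : K) : L :=
  (Finset.univ.filter fun x : L => y ≤ f x).inf id

/-- A finite distributive lattice (bundled, with `0` and `1`). -/
structure FinDistLat where
  carrier : Type
  [dist : DistribLattice carrier]
  [fin : Fintype carrier]
  [bdd : BoundedOrder carrier]

attribute [instance] FinDistLat.dist FinDistLat.fin FinDistLat.bdd

/-- Parameter words of length `n` over the alphabet `A` with `m` parameters, each of which occurs,
in the order of their first occurrences. After its first occurrence (`new`), a parameter is
treated as the additional letter `none`. -/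
inductive ParamWord : Type → ℕ → ℕ → Type 1
  | nil {A : Type} : ParamWord A 0 0
  | cons {A : Type} {n m : ℕ} (a : A) (w : ParamWord A n m) : ParamWord A (n + 1) m
  | new {A : Type} {n m : ℕ} (w : ParamWord (Option A) n m) : ParamWord A (n + 1) (m + 1)

namespace ParamWord

/-- Extend a substitution of letters by a value for the letter `none`. -/
def extend {A : Type} {B : Type*} (b : B) (σ : A → B) (o : Option A) : B := o.elim b σ

/-- Substitute the letters of `u` for the parameters of `w`, and letters along `σ`. -/
def comp {A B : Type} {n m k : ℕ} (σ : A → B) : ParamWord A n m → ParamWord B m k →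
    ParamWord B n k
  | nil, u => u
  | cons a w, u => cons (σ a) (comp σ w u)
  | new w, cons b u => cons b (comp (extend b σ) w u)
  | new w, new u => new (comp (Option.map σ) w u)

/-- Rename the letters of a parameter word. -/
def map {A B : Type} {n m : ℕ} (σ : A → B) : ParamWord A n m → ParamWord B n m
  | nil => nil
  | cons a w => cons (σ a) (map σ w)
  | new w => new (map (Option.map σ) w)

/-- The letters of a parameter word which precede the first parameter. -/
def pre {A : Type} {n m : ℕ} : ParamWord A n m → List A
  | nil => []
  | cons a w => a :: pre w
  | new _ => []

/-- Substitute the letters of `l` for the first parameters of `w`, stopping in front of the first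
parameter for which `l` contains no letter. -/
def subst {A B : Type} {n m : ℕ} (σ : A → B) : ParamWord A n m → List B → List B
  | nil, _ => []
  | cons a w, l => σ a :: subst σ w l
  | new _, [] => []
  | new w, b :: l => b :: subst (extend b σ) w l

/-- Append a new parameter. -/
def snoc {A : Type} {n m : ℕ} : ParamWord A n m → ParamWord A (n + 1) (m + 1)
  | nil => new nil
  | cons a w => cons a (snoc w)
  | new w => new (snoc w)

/-- The sequence obtained by interpreting letters along `g` and parameters along `h`. -/
def eval {A : Type} {X : Type*} {n m : ℕ} (g : A → X) (h : Fin m → X) :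
    ParamWord A n m → Fin n → X
  | nil => Fin.elim0
  | cons a w => Fin.cons (g a) (eval g h w)
  | new w => Fin.cons (h 0) (eval (extend (h 0) g) (Fin.tail h) w)

section laws

variable {A B C : Type}

theorem comp_extend {X Y : Type*} (τ : X → Y) (σ : A → X) (b : X) :
    τ ∘ extend b σ = extend (τ b) (τ ∘ σ) := by
  funext o; cases o <;> rfl

theorem extend_comp_map {X : Type*} (τ : B → X) (σ : A → B) (b : X) :
    extend b τ ∘ Option.map σ = extend b (τ ∘ σ) := by
  funext o; cases o <;> rfl

theorem comp_assoc {n m k p : ℕ} (w : ParamWord A n m) : ∀ {B C : Type} (σ : A → B) (τ : B → C)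
    (v : ParamWord B m k) (u : ParamWord C k p),
    comp τ (comp σ w v) u = comp (τ ∘ σ) w (comp τ v u) := by
  induction w generalizing k p with
  | nil => intros; simp [comp]
  | cons a w ih => intros; simp [comp, ih]
  | new w ih =>
    intro B C σ τ v u
    cases v with
    | cons b v => simp [comp, ih, comp_extend]
    | new v =>
      cases u with
      | cons c u => simp [comp, ih, extend_comp_map]
      | new u => simp [comp, ih, Option.map_comp_map]

theorem comp_map {n m k : ℕ} (w : ParamWord A n m) : ∀ {B C : Type} (σ : A → B) (τ : B → C)
    (u : ParamWord C m k), comp τ (map σ w) u = comp (τ ∘ σ) w u := by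
  induction w generalizing k with
  | nil => intros; simp [comp, map]
  | cons a w ih => intros; simp [comp, map, ih]
  | new w ih =>
    intro B C σ τ u
    cases u with
    | cons c u => simp [comp, map, ih, extend_comp_map]
    | new u => simp [comp, map, ih, Option.map_comp_map]

theorem pre_comp {n m k : ℕ} (w : ParamWord A n m) : ∀ {B : Type} (σ : A → B)
    (u : ParamWord B m k), pre (comp σ w u) = subst σ w (pre u) := by
  induction w generalizing k with
  | nil => intro B σ u; cases u; simp [comp, pre, subst]
  | cons a w ih => intros; simp [comp, pre, subst, ih]
  | new w ih => intro B σ u; cases u <;> simp [comp, pre, subst, ih]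

theorem subst_comp {n m k : ℕ} (w : ParamWord A n m) : ∀ {B C : Type} (σ : A → B) (τ : B → C)
    (u : ParamWord B m k) (l : List C),
    subst τ (comp σ w u) l = subst (τ ∘ σ) w (subst τ u l) := by
  induction w generalizing k with
  | nil => intro B C σ τ u l; cases u; simp [comp, subst]
  | cons a w ih => intros; simp [comp, subst, ih]
  | new w ih =>
    intro B C σ τ u l
    cases u with
    | cons b u => simp [comp, subst, ih, comp_extend]
    | new u => cases l <;> simp [comp, subst, ih, extend_comp_map]

theorem subst_snoc {n m : ℕ} (w : ParamWord A n m) : ∀ {B : Type} (σ : A → B) (l : List B),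
    l.length ≤ m → subst σ (snoc w) l = subst σ w l := by
  induction w with
  | nil => intro B σ l h; cases l <;> simp_all [snoc, subst]
  | cons a w ih => intro B σ l h; simp [snoc, subst, ih _ _ h]
  | new w ih =>
    intro B σ l h
    cases l with
    | nil => simp [snoc, subst]
    | cons b l => simp [snoc, subst, ih _ l (by simpa using h)]

theorem length_subst {n m : ℕ} (w : ParamWord A n m) : ∀ {B : Type} (σ : A → B) (l : List B),
    l.length = m → (subst σ w l).length = n := by
  induction w with
  | nil => intros; simp [subst]
  | cons a w ih => intro B σ l h; simp [subst, ih _ _ h]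
  | new w ih =>
    intro B σ l h
    cases l with
    | nil => simp at h
    | cons b l => simp [subst, ih _ l (by simpa using h)]

theorem length_pre {n : ℕ} {A : Type} (w : ParamWord A n 0) : (pre w).length = n := by
  generalize hm : 0 = m at w
  induction w with
  | nil => rfl
  | cons a w ih => simp [pre, ih hm]
  | new w ih => simp at hm

theorem length_pre_lt {n m : ℕ} (w : ParamWord A n m) (hm : 0 < m) : (pre w).length < n := by
  induction w with
  | nil => simp at hm
  | cons a w ih => simp [pre, ih hm]
  | new w ih => simp [pre]

theorem pre_injective {n : ℕ} {A : Type} (u v : ParamWord A n 0) (h : pre u = pre v) : u = v := by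
  generalize hm : 0 = m at u v
  induction u with
  | nil => cases v; rfl
  | cons a u ih =>
    cases v with
    | cons b v =>
      simp only [pre, List.cons.injEq] at h
      rw [h.1, ih hm v h.2]
    | new v => simp at hm
  | new u ih => simp at hm

theorem eval_comp {n m k : ℕ} (w : ParamWord A n m) : ∀ {B : Type} {X : Type*} (σ : A → B)
    (g : B → X) (h : Fin k → X) (u : ParamWord B m k),
    eval g h (comp σ w u) = eval (g ∘ σ) (eval g h u) w := by
  induction w generalizing k with
  | nil => intro B X σ g h u; cases u; simp [comp, eval]
  | cons a w ih => intros; simp [comp, eval, ih]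
  | new w ih =>
    intro B X σ g h u
    cases u with
    | cons b u => simp [comp, eval, ih, comp_extend]
    | new u => simp [comp, eval, ih, extend_comp_map]

theorem comp_eval {X Y : Type*} (f : X → Y) {n m : ℕ} (w : ParamWord A n m) :
    ∀ (g : A → X) (h : Fin m → X), f ∘ eval g h w = eval (f ∘ g) (f ∘ h) w := by
  induction w with
  | nil => intros; funext i; exact i.elim0
  | cons a w ih => intros; simp [eval, ← ih, ← Fin.comp_cons]
  | new w ih =>
    intro g h
    simp only [eval, Function.comp_apply, Fin.comp_cons, ih, comp_extend]
    rfl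

end laws

section eval

variable {A : Type} {X : Type*}

theorem exists_eval_eq {n m : ℕ} (w : ParamWord A n m) : ∀ (g : A → X) (h : Fin m → X)
    (j : Fin m), ∃ i, eval g h w i = h j := by
  induction w with
  | nil => intro g h j; exact j.elim0
  | cons a w ih =>
    intro g h j
    obtain ⟨i, hi⟩ := ih g h j
    exact ⟨i.succ, by simpa [eval] using hi⟩
  | new w ih =>
    intro g h j
    cases j using Fin.cases with
    | zero => exact ⟨0, by simp [eval]⟩
    | succ j =>
      obtain ⟨i, hi⟩ := ih (extend (h 0) g) (Fin.tail h) j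
      exact ⟨i.succ, hi⟩

theorem extend_ne_tail {m : ℕ} {g : A → X} {h : Fin (m + 1) → X} (hinj : Function.Injective h)
    (hgh : ∀ a j, g a ≠ h j) (o : Option A) (j : Fin m) : extend (h 0) g o ≠ Fin.tail h j := by
  cases o with
  | none => exact fun e => (Fin.succ_ne_zero j) (hinj e).symm
  | some a => exact hgh a j.succ

theorem tail_injective {m : ℕ} {h : Fin (m + 1) → X} (hinj : Function.Injective h) :
    Function.Injective (Fin.tail h) :=
  hinj.comp (Fin.succ_injective _)

theorem exists_lt_eval_eq {n m : ℕ} (w : ParamWord A n m) : ∀ (g : A → X) (h : Fin m → X),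
    Function.Injective h → (∀ a j, g a ≠ h j) → ∀ (j j' : Fin m), j < j' →
    ∀ i, eval g h w i = h j' → ∃ i' < i, eval g h w i' = h j := by
  induction w with
  | nil => intro g h _ _ j; exact j.elim0
  | cons a w ih =>
    intro g h hinj hgh j j' hj i hi
    cases i using Fin.cases with
    | zero => exact absurd (by simpa [eval] using hi) (hgh a j')
    | succ i =>
      obtain ⟨i', hi', he⟩ := ih g h hinj hgh j j' hj i (by simpa [eval] using hi)
      exact ⟨i'.succ, Fin.succ_lt_succ_iff.2 hi', by simpa [eval] using he⟩
  | new w ih =>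
    intro g h hinj hgh j j' hj i hi
    cases i using Fin.cases with
    | zero =>
      have : 0 = j' := hinj (by simpa [eval] using hi)
      subst this
      exact absurd hj (Fin.not_lt_zero j)
    | succ i =>
      cases j using Fin.cases with
      | zero => exact ⟨0, Fin.succ_pos i, by simp [eval]⟩
      | succ j =>
        cases j' using Fin.cases with
        | zero => exact absurd hj (Fin.not_lt_zero _)
        | succ j' =>
          obtain ⟨i', hi', he⟩ := ih _ _ (tail_injective hinj) (extend_ne_tail hinj hgh) j j'
            (Fin.succ_lt_succ_iff.1 hj) i hi
          exact ⟨i'.succ, Fin.succ_lt_succ_iff.2 hi', he⟩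

/-- Every sequence in which all the values of `h` occur, in the order of their first
occurrences, is given by a parameter word. -/
theorem exists_eq_eval {n : ℕ} : ∀ {A : Type} {m : ℕ} (g : A → X) (h : Fin m → X) (f : Fin n → X),
    Function.Injective h → (∀ a j, g a ≠ h j) →
    (∀ i, (∃ a, f i = g a) ∨ ∃ j, f i = h j) → (∀ j, ∃ i, f i = h j) →
    (∀ (j j' : Fin m), j < j' → ∀ i, f i = h j' → ∃ i' < i, f i' = h j) →
    ∃ w : ParamWord A n m, f = eval g h w := by
  induction n with
  | zero =>
    intro A m g h f _ _ _ hsurj _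
    cases m with
    | zero => exact ⟨nil, funext fun i => i.elim0⟩
    | succ m => exact (hsurj 0).choose.elim0
  | succ n ih =>
    intro A m g h f hinj hgh hmem hsurj hlt
    have hf : f = Fin.cons (f 0) (Fin.tail f) := (Fin.cons_self_tail f).symm
    rcases hmem 0 with ⟨a, ha⟩ | ⟨j, hj⟩
    · obtain ⟨w, hw⟩ := ih g h (Fin.tail f) hinj hgh (fun i => hmem i.succ)
        (fun j => by
          obtain ⟨i, hi⟩ := hsurj j
          cases i using Fin.cases with
          | zero => exact absurd (ha.symm.trans hi) (hgh a j)
          | succ i => exact ⟨i, hi⟩)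
        (fun j j' hjj i hi => by
          obtain ⟨i', hi', he⟩ := hlt j j' hjj i.succ hi
          cases i' using Fin.cases with
          | zero => exact absurd (ha.symm.trans he) (hgh a j)
          | succ i' => exact ⟨i', Fin.succ_lt_succ_iff.1 hi', he⟩)
      exact ⟨cons a w, by rw [hf, hw, ha, eval]⟩
    · cases m with
      | zero => exact j.elim0
      | succ m =>
        have hj0 : j = 0 := by
          by_contra hne
          obtain ⟨i', hi', -⟩ := hlt 0 j (Fin.pos_of_ne_zero hne) 0 hj
          exact Fin.not_lt_zero _ hi'
        subst hj0
        obtain ⟨w, hw⟩ := ih (extend (h 0) g) (Fin.tail h) (Fin.tail f) (tail_injective hinj)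
          (extend_ne_tail hinj hgh)
          (fun i => by
            rcases hmem i.succ with ⟨a, ha⟩ | ⟨j, hj⟩
            · exact Or.inl ⟨some a, ha⟩
            · cases j using Fin.cases with
              | zero => exact Or.inl ⟨none, hj⟩
              | succ j => exact Or.inr ⟨j, hj⟩)
          (fun j => by
            obtain ⟨i, hi⟩ := hsurj j.succ
            cases i using Fin.cases with
            | zero => exact absurd (hinj (hj.symm.trans hi)).symm (Fin.succ_ne_zero j)
            | succ i => exact ⟨i, hi⟩)
          (fun j j' hjj i hi => by
            obtain ⟨i', hi', he⟩ := hlt j.succ j'.succ (Fin.succ_lt_succ_iff.2 hjj) i.succ hi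
            cases i' using Fin.cases with
            | zero => exact absurd (hinj (hj.symm.trans he)).symm (Fin.succ_ne_zero j)
            | succ i' => exact ⟨i', Fin.succ_lt_succ_iff.1 hi', he⟩)
        exact ⟨new w, by rw [hf, hw, hj, eval]⟩

end eval

section ramsey

open Combinatorics

theorem exists_subst_eq_ofFn {n : ℕ} : ∀ {A : Type} {m : ℕ} {η : Type} [Fintype η]
    (v : Fin n → A ⊕ η), Fintype.card η = m → (∀ e, ∃ i, v i = Sum.inr e) →
    ∃ w : ParamWord A n m, ∀ {B : Type} (σ : A → B) (l : List B), l.length = m →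
      ∃ x : η → B, subst σ w l = List.ofFn fun i => (v i).elim σ x := by
  classical
  induction n with
  | zero =>
    intro A m η _ v hη hv
    have : IsEmpty η := ⟨fun e => (hv e).choose.elim0⟩
    obtain rfl : m = 0 := by rw [← hη, Fintype.card_eq_zero]
    exact ⟨nil, fun σ l _ => ⟨isEmptyElim, by simp [subst]⟩⟩
  | succ n ih =>
    intro A m η _ v hη hv
    rcases h0 : v 0 with a | e
    · obtain ⟨w, hw⟩ := ih (Fin.tail v) hη (fun e => by
        obtain ⟨i, hi⟩ := hv e
        cases i using Fin.cases with
        | zero => simp [h0] at hi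
        | succ i => exact ⟨i, hi⟩)
      refine ⟨cons a w, fun σ l hl => ?_⟩
      obtain ⟨x, hx⟩ := hw σ l hl
      exact ⟨x, by simp [subst, hx, List.ofFn_succ, h0, Fin.tail]⟩
    · have hcard : Fintype.card {y // y ≠ e} + 1 = m := by
        rw [← hη, Fintype.card_subtype_compl, Fintype.card_subtype_eq]
        exact Nat.sub_add_cancel (Fintype.card_pos_iff.2 ⟨e⟩)
      subst hcard
      let c : A ⊕ η → Option A ⊕ {y // y ≠ e} := fun s =>
        s.elim (fun a => Sum.inl (some a))
          fun y => if h : y = e then Sum.inl none else Sum.inr ⟨y, h⟩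
      obtain ⟨w, hw⟩ := ih (fun i => c (v i.succ)) rfl (fun y => by
        obtain ⟨i, hi⟩ := hv y
        cases i using Fin.cases with
        | zero => exact absurd (Sum.inr.inj (h0.symm.trans hi)).symm y.2
        | succ i => exact ⟨i, by simp [c, hi, y.2]⟩)
      refine ⟨new w, fun σ l hl => ?_⟩
      cases l with
      | nil => simp at hl
      | cons b l =>
        obtain ⟨x, hx⟩ := hw (extend b σ) l (by simpa using hl)
        refine ⟨fun y => if h : y = e then b else x ⟨y, h⟩, ?_⟩
        simp only [subst, hx, List.ofFn_succ, h0, Sum.elim_inr, dite_true, List.cons.injEq,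
          true_and]
        congr 1
        funext i
        rcases v i.succ with a | y
        · simp [c, extend]
        · by_cases h : y = e <;> simp [c, h, extend]

/-- The multidimensional Hales-Jewett theorem. -/
theorem exists_subst_mono (A C : Type) [Finite A] [Finite C] (m : ℕ) :
    ∃ n, ∀ F : List A → C, ∃ w : ParamWord A n m, ∀ l l' : List A, l.length = m → l'.length = m →
      F (subst id w l) = F (subst id w l') := by
  obtain ⟨n, hn⟩ := Subspace.exists_mono_in_high_dimension_fin A C (Fin m)
  refine ⟨n, fun F => ?_⟩
  obtain ⟨S, c, hc⟩ := hn fun x => F (List.ofFn x)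
  obtain ⟨w, hw⟩ := exists_subst_eq_ofFn S.idxFun (Fintype.card_fin m) S.proper
  have key : ∀ l : List A, l.length = m → F (subst id w l) = c := by
    intro l hl
    obtain ⟨x, hx⟩ := hw id l hl
    rw [hx, ← hc x]
    congr 2
  exact ⟨w, fun l l' hl hl' => (key l hl).trans (key l' hl').symm⟩

theorem exists_subst_eq_of_length_eq (A C : Type) [Finite A] [Finite C] (m : ℕ) :
    ∃ n, ∀ F : List A → C, ∃ w : ParamWord A n m, ∀ l l' : List A, l.length < m →
      l.length = l'.length → F (subst id w l) = F (subst id w l') := by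
  induction m with
  | zero => exact ⟨0, fun F => ⟨nil, by simp⟩⟩
  | succ m ih =>
    obtain ⟨N, hN⟩ := ih
    obtain ⟨n, hn⟩ := exists_subst_mono A C N
    refine ⟨n + 1, fun F => ?_⟩
    obtain ⟨v, hv⟩ := hn F
    obtain ⟨w, hw⟩ := hN fun l => F (subst id v l)
    refine ⟨snoc (comp id v w), fun l l' hl hll => ?_⟩
    rw [subst_snoc _ _ _ (by omega), subst_snoc _ _ _ (by omega), subst_comp, subst_comp]
    rcases (Nat.lt_succ_iff.1 hl).lt_or_eq with h | h
    · exact hw l l' h hll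
    · exact hv _ _ (length_subst _ _ _ h) (length_subst _ _ _ (hll.symm.trans h))

theorem exists_length_subst_mem {M : ℕ} : ∀ {A : Type} [Nonempty A] {m : ℕ} (S : ℕ → Prop)
    [DecidablePred S], m ≤ Nat.count S M → ∃ w : ParamWord A M m, ∀ {B : Type} (σ : A → B)
      (l : List B), l.length < m → S (subst σ w l).length := by
  induction M with
  | zero =>
    intro A _ m S _ hm
    obtain rfl : m = 0 := by simpa using hm
    exact ⟨nil, by simp⟩
  | succ M ih =>
    intro A _ m S _ hm
    rw [Nat.count_succ'] at hm
    by_cases h : S 0 ∧ m ≠ 0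
    · obtain ⟨m, rfl⟩ := Nat.exists_eq_succ_of_ne_zero h.2
      obtain ⟨w, hw⟩ := ih (A := Option A) (m := m) (fun k => S (k + 1)) (by
        rw [if_pos h.1] at hm; omega)
      refine ⟨new w, fun σ l hl => ?_⟩
      cases l with
      | nil => simpa [subst] using h.1
      | cons b l => simpa [subst] using hw (extend b σ) l (by simpa using hl)
    · obtain ⟨w, hw⟩ := ih (A := A) (m := m) (fun k => S (k + 1)) (by
        rcases Nat.eq_zero_or_pos m with h0 | h0
        · omega
        · rw [if_neg fun hS => h ⟨hS, by omega⟩] at hm; omega)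
      refine ⟨cons (Classical.arbitrary A) w, fun σ l hl => ?_⟩
      simpa [subst] using hw σ l hl

theorem exists_subst_mono_of_length_lt (A C : Type) [Finite A] [Nonempty A] [Finite C] (m : ℕ) :
    ∃ n, ∀ F : List A → C, ∃ w : ParamWord A n m, ∀ l l' : List A, l.length < m → l'.length < m →
      F (subst id w l) = F (subst id w l') := by
  classical
  have := Fintype.ofFinite C
  obtain ⟨n, hn⟩ := exists_subst_eq_of_length_eq A C (Fintype.card C * m)
  refine ⟨n, fun F => ?_⟩
  obtain ⟨v, hv⟩ := hn F
  let g : ℕ → C := fun p => F (subst id v (List.replicate p (Classical.arbitrary A)))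
  have hC : Nonempty C := ⟨g 0⟩
  obtain ⟨c, -, hc⟩ := Finset.exists_le_card_fiber_of_mul_le_card_of_maps_to
    (s := Finset.range (Fintype.card C * m)) (t := Finset.univ) (f := g) (n := m)
    (fun _ _ => Finset.mem_univ _) Finset.univ_nonempty (by simp)
  rw [← Nat.count_eq_card_filter_range (fun p => g p = c)] at hc
  obtain ⟨w, hw⟩ := exists_length_subst_mem (A := A) (M := Fintype.card C * m)
    (fun p => g p = c ∧ p < Fintype.card C * m) (hc.trans (by
      rw [Nat.count_eq_card_filter_range, Nat.count_eq_card_filter_range]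
      exact Finset.card_le_card fun p hp => by simp_all))
  have key : ∀ l : List A, l.length < m → F (subst id (comp id v w) l) = c := by
    intro l hl
    obtain ⟨h1, h2⟩ := hw id l hl
    rw [subst_comp, ← h1]
    exact hv _ _ h2 (by simp)
  exact ⟨comp id v w, fun l l' hl hl' => (key l hl).trans (key l' hl').symm⟩

/-- If the Graham-Rothschild theorem holds for `k` parameters, then any coloring of words with
`k + 1` parameters can be made to depend only on the letters in front of the first parameter. -/
theorem exists_comp_eq_of_pre_eq {k : ℕ}
    (hk : ∀ (A C : Type) [Finite A] [Nonempty A] [Finite C] (m : ℕ), ∃ n,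
      ∀ χ : ParamWord A n k → C, ∃ w : ParamWord A n m, ∀ u u' : ParamWord A m k,
        χ (comp id w u) = χ (comp id w u')) (A : Type) [Finite A] (M : ℕ) :
    ∀ (C : Type) [Finite C], ∃ n, ∀ χ : ParamWord A n (k + 1) → C, ∃ w : ParamWord A n M,
      ∀ u u' : ParamWord A M (k + 1), pre u = pre u' → χ (comp id w u) = χ (comp id w u') := by
  induction M with
  | zero => exact fun C _ => ⟨0, fun χ => ⟨nil, fun u => by cases u⟩⟩
  | succ M ih =>
    intro C _
    obtain ⟨n₁, h₁⟩ := ih (A → C)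
    obtain ⟨n₂, h₂⟩ := hk (Option A) C n₁
    refine ⟨n₂ + 1, fun χ => ?_⟩
    obtain ⟨w₁, hw₁⟩ := h₂ fun u => χ (new u)
    obtain ⟨w₂, hw₂⟩ := h₁ fun u a => χ (cons a (comp (extend a id) w₁ u))
    refine ⟨new (comp id w₁ (map some w₂)), fun u u' h => ?_⟩
    have hs (a : A) : extend a id ∘ some = id := rfl
    cases u with
    | cons a u =>
      cases u' with
      | cons a' u' =>
        simp only [pre, List.cons.injEq] at h
        obtain ⟨rfl, h⟩ := h
        simpa [comp, comp_assoc, comp_map, hs] using congrFun (hw₂ u u' h) a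
      | new u' => simp [pre] at h
    | new u =>
      cases u' with
      | cons a' u' => simp [pre] at h
      | new u' => simpa [comp, comp_assoc] using hw₁ _ _

/-- The **Graham-Rothschild theorem** for parameter words. -/
theorem graham_rothschild (k : ℕ) : ∀ (A C : Type) [Finite A] [Nonempty A] [Finite C] (m : ℕ),
    ∃ n, ∀ χ : ParamWord A n k → C, ∃ w : ParamWord A n m, ∀ u u' : ParamWord A m k,
      χ (comp id w u) = χ (comp id w u') := by
  classical
  induction k with
  | zero =>
    intro A C _ _ _ m
    obtain ⟨n, hn⟩ := exists_subst_mono A (Option C) m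
    refine ⟨n, fun χ => ?_⟩
    obtain ⟨w, hw⟩ := hn fun l => if h : ∃ u : ParamWord A n 0, pre u = l then
      some (χ h.choose) else none
    have key (u : ParamWord A m 0) : (if h : ∃ v : ParamWord A n 0, pre v = subst id w (pre u) then
        some (χ h.choose) else none) = some (χ (comp id w u)) := by
      have h : ∃ v : ParamWord A n 0, pre v = subst id w (pre u) := ⟨_, pre_comp w id u⟩
      rw [dif_pos h, pre_injective _ _ (h.choose_spec.trans (pre_comp w id u).symm)]
    refine ⟨w, fun u u' => Option.some_injective _ ?_⟩
    rw [← key u, ← key u']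
    exact hw _ _ (length_pre u) (length_pre u')
  | succ k ih =>
    intro A C _ _ _ m
    obtain ⟨M, hM⟩ := exists_subst_mono_of_length_lt A (Option C) m
    obtain ⟨n, hn⟩ := exists_comp_eq_of_pre_eq ih A M C
    refine ⟨n, fun χ => ?_⟩
    obtain ⟨v, hv⟩ := hn χ
    obtain ⟨w, hw⟩ := hM fun l => if h : ∃ u : ParamWord A M (k + 1), pre u = l then
      some (χ (comp id v h.choose)) else none
    have key (u : ParamWord A m (k + 1)) :
        (if h : ∃ u' : ParamWord A M (k + 1), pre u' = subst id w (pre u) then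
          some (χ (comp id v h.choose)) else none) = some (χ (comp id (comp id v w) u)) := by
      have h : ∃ u' : ParamWord A M (k + 1), pre u' = subst id w (pre u) := ⟨_, pre_comp w id u⟩
      rw [dif_pos h, hv _ (comp id w u) (h.choose_spec.trans (pre_comp w id u).symm), comp_assoc]
      rfl
    refine ⟨comp id v w, fun u u' => Option.some_injective _ ?_⟩
    rw [← key u, ← key u']
    exact hw _ _ (length_pre_lt u k.succ_pos) (length_pre_lt u' k.succ_pos)

end ramsey

end ParamWord

section lattice

variable {L K : Type*}

theorem joinIrred_iff_supIrred [Lattice L] [OrderBot L] {j : L} : JoinIrred j ↔ SupIrred j := by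
  simp only [JoinIrred, SupIrred, isMin_iff_eq_bot]
  exact and_congr_right fun _ => ⟨fun h a b e => (h a b e.symm).imp Eq.symm Eq.symm,
    fun h a b e => (h e.symm).imp Eq.symm Eq.symm⟩

open Classical in
theorem minus_le [Lattice L] [OrderBot L] [Fintype L] (x : L) (S : Set L) : minus x S ≤ x :=
  Finset.sup_le fun _ hj => (Finset.mem_filter.1 hj).2.2.1

open Classical in
theorem JoinIrred.le_minus [Lattice L] [OrderBot L] [Fintype L] {j x : L} {S : Set L}
    (hj : JoinIrred j) (hjx : j ≤ x) (hjS : j ∉ S) : j ≤ minus x S :=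
  Finset.le_sup (f := id) (Finset.mem_filter.2 ⟨Finset.mem_univ _, hj, hjx, hjS⟩)

open Classical in
theorem minus_mono [Lattice L] [OrderBot L] [Fintype L] {x y : L} (h : x ≤ y) (S : Set L) :
    minus x S ≤ minus y S :=
  Finset.sup_le fun _ hj => by
    obtain ⟨-, hj, hjx, hjS⟩ := Finset.mem_filter.1 hj
    exact hj.le_minus (hjx.trans h) hjS

theorem IsBddLatticeHom.monotone [Lattice L] [BoundedOrder L] [Lattice K] [BoundedOrder K]
    {f : L → K} (hf : IsBddLatticeHom f) : Monotone f := fun x y h => by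
  rw [← sup_eq_right, ← hf.1, sup_eq_right.2 h]

theorem IsBddLatticeHom.map_minus_latN [Lattice L] [BoundedOrder L] [Fintype L] [Lattice K]
    [BoundedOrder K] {f : L → K} (hf : IsBddLatticeHom f) (x : L) :
    f (minus x (latN f)) = f x := by
  induction x using WellFoundedLT.induction with
  | ind x ih =>
    refine (hf.monotone (minus_le _ _)).antisymm ?_
    have hlt {y : L} (hy : y < x) : f y ≤ f (minus x (latN f)) :=
      (ih y hy).symm.trans_le (hf.monotone (minus_mono hy.le _))
    by_cases hN : x ∈ latN f
    · obtain ⟨y, hy, he⟩ := hN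
      exact he ▸ hlt hy
    by_cases hj : JoinIrred x
    · exact hf.monotone (hj.le_minus le_rfl hN)
    · simp only [JoinIrred, not_and_or, not_forall, not_or, not_not] at hj
      rcases hj with rfl | ⟨a, b, hab, ha, hb⟩
      · rw [hf.2.2.1]; exact bot_le
      · calc f x = f a ⊔ f b := by rw [← hf.1, ← hab]
          _ ≤ _ := sup_le (hlt ((hab ▸ le_sup_left).lt_of_ne (Ne.symm ha)))
            (hlt ((hab ▸ le_sup_right).lt_of_ne (Ne.symm hb)))

theorem IsNaturalOrder.of_le [Lattice L] [BoundedOrder L] {r : L → L → Prop}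
    (hr : IsNaturalOrder r) {x y : L} (h : x ≤ y) : r x y := by
  have := hr.1
  rcases eq_or_ne x y with rfl | hne
  · exact refl_of r x
  · refine (total_of r x y).resolve_right fun hyx => ?_
    obtain ⟨j, -, hjx, hjy, -⟩ := (hr.2.2 y x hne.symm).1 hyx
    exact hjy (hjx.trans h)

/-- Preimages under a positive surjective homomorphism first occur in the natural order. -/
theorem IsPositive.exists_lt_map_eq [Lattice L] [BoundedOrder L] [Fintype L] [Lattice K]
    [BoundedOrder K] {rL : L → L → Prop} {rK : K → K → Prop} (hL : IsNaturalOrder rL)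
    (hK : IsNaturalOrder rK) {f : L → K} (hf : IsBddLatticeHom f) (hs : Function.Surjective f)
    (hp : IsPositive rL rK f) {x' : L} {y : K} (hy : rK y (f x')) (hne : y ≠ f x') :
    ∃ x, rL x x' ∧ x ≠ x' ∧ f x = y := by
  have := hL.1
  have := hK.1
  obtain ⟨x, rfl⟩ := hs y
  refine ⟨minus x (latN f), ?_, ?_, hf.map_minus_latN x⟩
  · refine (total_of rL _ _).resolve_right fun h => hne ?_
    refine antisymm_of rK hy (hp x' x ?_)
    exact trans_of rL (hL.of_le (minus_le _ _)) h
  · rintro h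
    exact hne (by rw [← h, hf.map_minus_latN])

theorem exists_enumeration {X : Type*} [Finite X] (r : X → X → Prop) (hr : IsLinearOrder X r)
    (p : X → Prop) : ∃ (m : ℕ) (h : Fin m → X), Function.Injective h ∧ (∀ x, p x ↔ ∃ j, h j = x) ∧
      ∀ j j', r (h j) (h j') ↔ j ≤ j' := by
  classical
  have := Fintype.ofFinite X
  let _ : LinearOrder X :=
    { le := r
      le_refl := refl_of r
      le_trans := fun _ _ _ => trans_of r
      le_antisymm := fun _ _ => antisymm_of r
      le_total := total_of r
      toDecidableLE := Classical.decRel _ }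
  let e := Fintype.orderIsoFinOfCardEq {x // p x} rfl
  refine ⟨_, fun j => e j, Subtype.val_injective.comp e.injective, fun x => ⟨fun hx => ?_, ?_⟩,
    fun j j' => e.le_iff_le⟩
  · exact ⟨e.symm ⟨x, hx⟩, by simp⟩
  · rintro ⟨j, rfl⟩
    exact (e j).2

end lattice

section antilex

variable {P Λ : Type*} [PartialOrder P] [LinearOrder Λ]

/-- The antilexicographic order on lower sets of `P` determined by `τ`. -/
def Antilex (τ : P → Λ) (D E : LowerSet P) : Prop :=
  ∀ a ∈ D, a ∉ E → ∃ b ∈ E, b ∉ D ∧ τ a ≤ τ b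

variable {τ : P → Λ}

theorem antilex_Iic_iff (hτ : Function.Injective τ) (hm : Monotone τ) {a b : P} :
    Antilex τ (LowerSet.Iic a) (LowerSet.Iic b) ↔ τ a ≤ τ b := by
  constructor
  · intro h
    by_cases hab : a ≤ b
    · exact hm hab
    · obtain ⟨c, hc, -, hac⟩ := h a (LowerSet.mem_Iic_iff.2 le_rfl) hab
      exact hac.trans (hm hc)
  · intro h x hx hxb
    refine ⟨b, LowerSet.mem_Iic_iff.2 le_rfl, fun hba => hxb ?_, (hm hx).trans h⟩
    rwa [← hτ (h.antisymm (hm hba))]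

variable [Finite P]

theorem isLinearOrder_antilex (hτ : Function.Injective τ) :
    IsLinearOrder (LowerSet P) (Antilex τ) := by
  let F : LowerSet P → Finset Λ := fun D => (Set.toFinite (D : Set P)).toFinset.map ⟨τ, hτ⟩
  have hmem (D : LowerSet P) (a : P) : τ a ∈ F D ↔ a ∈ D := by simp [F]
  have hF : Function.Injective F := fun D E h => SetLike.ext fun a => by
    rw [← hmem, ← hmem, h]
  have hle (D E : LowerSet P) : Antilex τ D E ↔ toColex (F D) ≤ toColex (F E) := by
    have hex (D : LowerSet P) (x : Λ) : x ∈ F D ↔ ∃ a ∈ D, τ a = x := by simp [F]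
    simp only [Finset.Colex.toColex_le_toColex, Antilex]
    constructor
    · intro h x hx hxE
      obtain ⟨a, ha, rfl⟩ := (hex _ _).1 hx
      obtain ⟨b, hb, hbD, hab⟩ := h a ha (mt (hmem _ _).2 hxE)
      exact ⟨τ b, (hmem _ _).2 hb, mt (hmem _ _).1 hbD, hab⟩
    · intro h a ha haE
      obtain ⟨x, hx, hxD, hax⟩ := h ((hmem _ _).2 ha) (mt (hmem _ _).1 haE)
      obtain ⟨b, hb, rfl⟩ := (hex _ _).1 hx
      exact ⟨b, hb, mt (hmem _ _).2 hxD, hax⟩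
  exact
    { refl := fun D => (hle _ _).2 le_rfl
      trans := fun D E G h h' => (hle _ _).2 (((hle _ _).1 h).trans ((hle _ _).1 h'))
      antisymm := fun D E h h' => hF (toColex_inj.1 (((hle _ _).1 h).antisymm ((hle _ _).1 h')))
      total := fun D E => by simpa only [hle] using le_total _ _ }

theorem isNaturalOrder_antilex [BoundedOrder (LowerSet P)] (hτ : Function.Injective τ)
    (hm : Monotone τ) : IsNaturalOrder (Antilex τ) := by
  refine ⟨isLinearOrder_antilex hτ, fun j j' _ _ h a ha ha' => absurd (h ha) ha', ?_⟩
  intro D E hne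
  simp only [joinIrred_iff_supIrred, LowerSet.supIrred_iff_of_finite]
  constructor
  · intro h
    obtain ⟨c, hc, hmax⟩ := (Set.toFinite {c : P | ¬ (c ∈ D ↔ c ∈ E)}).exists_maximalFor τ _ (by
      by_contra hemp
      refine hne (SetLike.ext fun c => ?_)
      by_contra hc
      exact hemp ⟨c, hc⟩)
    have hmax' (b : P) (hb : ¬ (b ∈ D ↔ b ∈ E)) : τ b ≤ τ c :=
      (le_total (τ b) (τ c)).elim id fun h => hmax hb h
    have hcE : c ∈ E ∧ c ∉ D := by
      by_contra hcE
      have hcD : c ∈ D ∧ c ∉ E := by simp only [Set.mem_ofPred_eq] at hc; tauto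
      obtain ⟨b, hb, hbD, hcb⟩ := h c hcD.1 hcD.2
      rw [hτ (hcb.antisymm (hmax' b (by tauto)))] at hcD
      exact hcD.2 hb
    refine ⟨_, ⟨c, rfl⟩, LowerSet.Iic_le.2 hcE.1, fun h => hcE.2 (LowerSet.Iic_le.1 h), ?_⟩
    rintro _ ⟨b, rfl⟩ hb
    rw [LowerSet.Iic_le, LowerSet.Iic_le] at hb
    exact (antilex_Iic_iff hτ hm).2 (hmax' b hb)
  · rintro ⟨_, ⟨b, rfl⟩, hbE, hbD, hb⟩ a haD haE
    rw [LowerSet.Iic_le] at hbE hbD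
    refine ⟨b, hbE, hbD, (antilex_Iic_iff hτ hm).1 (hb _ ⟨a, rfl⟩ ?_)⟩
    rw [LowerSet.Iic_le, LowerSet.Iic_le]
    tauto

end antilex

section freeHom

variable {L K : Type*} {M : ℕ}

open Classical in
/-- The homomorphism from the free bounded distributive lattice on `M` generators (the lower sets
of the `M`-dimensional cube) which maps the generators to `t`. -/
noncomputable def freeHom [Lattice L] [BoundedOrder L] (t : Fin M → L)
    (D : LowerSet (Fin M → Bool)) : L :=
  (Finset.univ.filter (· ∈ D)).sup fun S => (Finset.univ.filter fun i => S i = false).inf t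

theorem comp_freeHom [Lattice L] [BoundedOrder L] [Lattice K] [BoundedOrder K] {f : L → K}
    (hf : IsBddLatticeHom f) (t : Fin M → L) : f ∘ freeHom t = freeHom (f ∘ t) := by
  funext D
  simp only [freeHom, Function.comp_apply]
  rw [Finset.apply_sup_eq_sup_comp f hf.1 hf.2.2.1]
  congr 1
  funext S
  exact Finset.apply_inf_eq_inf_comp f hf.2.1 hf.2.2.2

open Classical in
/-- The point of the cube which corresponds to the join-irreducible element `j`. -/
noncomputable def code [Preorder L] (t : Fin M → L) (j : L) (i : Fin M) : Bool :=
  decide ¬ j ≤ t i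

variable [DistribLattice L] [BoundedOrder L] {t : Fin M → L} {D E : LowerSet (Fin M → Bool)}

theorem JoinIrred.le_freeHom_iff {j : L} (hj : JoinIrred j) : j ≤ freeHom t D ↔ code t j ∈ D := by
  rw [freeHom, (joinIrred_iff_supIrred.1 hj).supPrime.le_finset_sup]
  simp only [Finset.mem_filter, Finset.mem_univ, true_and, Finset.le_inf_iff]
  constructor
  · rintro ⟨S, hS, h⟩
    refine D.lower (fun i => ?_) hS
    cases hi : S i
    · simp [code, h i hi]
    · exact Bool.le_true _
  · exact fun h => ⟨_, h, fun i hi => by simpa [code] using hi⟩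

theorem freeHom_mono (h : D ≤ E) : freeHom t D ≤ freeHom t E :=
  Finset.sup_mono fun S hS => by
    simp only [Finset.mem_filter, Finset.mem_univ, true_and] at hS ⊢
    exact h hS

theorem isBddLatticeHom_freeHom (t : Fin M → L) : IsBddLatticeHom (freeHom t) := by
  classical
  refine ⟨fun D E => ?_, fun D E => ?_, ?_, ?_⟩
  · simp only [freeHom, LowerSet.mem_sup_iff, Finset.filter_or, Finset.sup_union]
  · refine (le_inf (freeHom_mono inf_le_left) (freeHom_mono inf_le_right)).antisymm ?_
    rw [freeHom, freeHom, Finset.sup_inf_sup]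
    refine Finset.sup_le fun p hp => ?_
    simp only [Finset.mem_product, Finset.mem_filter, Finset.mem_univ, true_and] at hp
    refine le_trans ?_ (Finset.le_sup (b := p.1 ⊓ p.2) (Finset.mem_filter.2 ⟨Finset.mem_univ _,
      D.lower inf_le_left hp.1, E.lower inf_le_right hp.2⟩))
    refine Finset.le_inf fun i hi => ?_
    simp only [Finset.mem_filter, Finset.mem_univ, true_and, Pi.inf_apply] at hi
    cases h1 : p.1 i
    · exact inf_le_left.trans (Finset.inf_le (by simp [h1]))
    · cases h2 : p.2 i
      · exact inf_le_right.trans (Finset.inf_le (by simp [h2]))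
      · simp [h1, h2] at hi
  · simp [freeHom]
  · refine top_le_iff.1 (le_trans ?_ (Finset.le_sup (b := ⊤) (by simp)))
    simp

theorem exists_freeHom_eq (t : Fin M → L) (i : Fin M) : ∃ D, freeHom t D = t i := by
  classical
  let D : LowerSet (Fin M → Bool) :=
    ⟨{S | S i = false}, fun S T h hS => le_bot_iff.1 ((h i).trans_eq hS)⟩
  refine ⟨D, (Finset.sup_le fun S hS => Finset.inf_le ?_).antisymm
    (le_trans ?_ (Finset.le_sup (b := fun i' => decide (i' ≠ i)) ?_))⟩
  · exact Finset.mem_filter.2 ⟨Finset.mem_univ _, (Finset.mem_filter.1 hS).2⟩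
  · refine Finset.le_inf fun i' hi' => ?_
    obtain rfl : i' = i := by simpa using hi'
    exact le_rfl
  · refine Finset.mem_filter.2 ⟨Finset.mem_univ _, ?_⟩
    change decide (i ≠ i) = false
    simp

/-- The nonzero elements of `L` occur in `t`, in the order `r` of their first occurrences. -/
structure IsRigid (r : L → L → Prop) (t : Fin M → L) : Prop where
  exists_eq : ∀ x ≠ ⊥, ∃ i, t i = x
  exists_lt : ∀ x x', x ≠ ⊥ → x ≠ x' → r x x' → ∀ i, t i = x' → ∃ i' < i, t i' = x

variable {r : L → L → Prop}

theorem IsRigid.surjective (ht : IsRigid r t) : Function.Surjective (freeHom t) := fun x => by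
  rcases eq_or_ne x ⊥ with rfl | hx
  · exact ⟨⊥, (isBddLatticeHom_freeHom t).2.2.1⟩
  · obtain ⟨i, rfl⟩ := ht.exists_eq x hx
    exact exists_freeHom_eq t i

theorem IsRigid.code_lt_code (ht : IsRigid r t) (hr : IsNaturalOrder r) {j j' : L} (hj : j ≠ ⊥)
    (hne : j ≠ j') (hjj : r j j') : toLex (code t j) < toLex (code t j') := by
  classical
  have := hr.1
  obtain ⟨i, hi, hmin⟩ : ∃ i, t i = j ∧ ∀ i' < i, t i' ≠ j := by
    obtain ⟨i, hi, hmin⟩ := WellFounded.has_min wellFounded_lt {i | t i = j} (ht.exists_eq j hj)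
    exact ⟨i, hi, fun i' hi' he => hmin i' he hi'⟩
  have hnot (i' : Fin M) (hi' : i' < i) : ¬ r j (t i') := fun h => by
    obtain ⟨i'', h'', he⟩ := ht.exists_lt j (t i') hj (hmin i' hi').symm h i' rfl
    exact hmin i'' (h''.trans hi') he
  refine ⟨i, fun i' hi' => ?_, ?_⟩
  · have h1 : ¬ j ≤ t i' := fun h => hnot i' hi' (hr.of_le h)
    have h2 : ¬ j' ≤ t i' := fun h => hnot i' hi' (trans_of r hjj (hr.of_le h))
    simp [code, h1, h2]
  · have h2 : ¬ j' ≤ j := fun h => hne (antisymm_of r hjj (hr.of_le h))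
    simp [code, hi, h2]

theorem Iic_code_notMem_latN {j : L} (hj : JoinIrred j) :
    LowerSet.Iic (code t j) ∉ latN (freeHom t) := by
  rintro ⟨y, hy, he⟩
  have : j ≤ freeHom t y := he ▸ hj.le_freeHom_iff.2 (LowerSet.mem_Iic_iff.2 le_rfl)
  exact hy.not_ge (LowerSet.Iic_le.2 (hj.le_freeHom_iff.1 this))

theorem exists_code_eq (hr : IsNaturalOrder r) {c : Fin M → Bool}
    (hc : LowerSet.Iic c ∉ latN (freeHom t)) : ∃ j, JoinIrred j ∧ code t j = c := by
  let y := (LowerSet.Iic c).erase c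
  have hy : y < LowerSet.Iic c := LowerSet.erase_lt.2 (LowerSet.mem_Iic_iff.2 le_rfl)
  have hle : freeHom t y ≤ freeHom t (LowerSet.Iic c) := freeHom_mono hy.le
  have hne : freeHom t y ≠ freeHom t (LowerSet.Iic c) := fun h => hc ⟨y, hy, h⟩
  obtain ⟨j, hj, hjc, hjy, -⟩ := (hr.2.2 _ _ hne).1 (hr.of_le hle)
  rw [hj.le_freeHom_iff] at hjc hjy
  refine ⟨j, hj, by_contra fun h => hjy ?_⟩
  exact ⟨hjc, fun hcj => h (le_antisymm (LowerSet.mem_Iic_iff.1 hjc) hcj)⟩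

theorem mem_minus_iff [Fintype (LowerSet (Fin M → Bool))] {S : Set (LowerSet (Fin M → Bool))}
    {b : Fin M → Bool} : b ∈ minus D S ↔ ∃ c, b ≤ c ∧ c ∈ D ∧ LowerSet.Iic c ∉ S := by
  simp only [minus, joinIrred_iff_supIrred, LowerSet.supIrred_iff_of_finite, Finset.sup_eq_iSup,
    LowerSet.mem_iSup_iff, Finset.mem_filter, Finset.mem_univ, true_and, exists_prop, id]
  constructor
  · rintro ⟨_, ⟨⟨c, rfl⟩, hcD, hcS⟩, hb⟩
    exact ⟨c, hb, LowerSet.Iic_le.1 hcD, hcS⟩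
  · rintro ⟨c, hb, hcD, hcS⟩
    exact ⟨_, ⟨⟨c, rfl⟩, LowerSet.Iic_le.2 hcD, hcS⟩, hb⟩

theorem IsRigid.isPositive [Fintype (LowerSet (Fin M → Bool))] (hr : IsNaturalOrder r)
    (ht : IsRigid r t) : IsPositive (Antilex toLex) r (freeHom t) := by
  have := hr.1
  intro D E h
  by_contra hDE
  have hED := (total_of r (freeHom t D) (freeHom t E)).resolve_left hDE
  obtain ⟨j, hj, hjD, hjE, hmax⟩ := (hr.2.2 _ _ fun e => hDE (by rw [e]; exact refl_of r _)).1 hED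
  have hjN := Iic_code_notMem_latN (t := t) hj
  obtain ⟨b, hbE, hbD, hb⟩ := h (code t j)
    (mem_minus_iff.2 ⟨_, le_rfl, hj.le_freeHom_iff.1 hjD, hjN⟩) fun hjE' => by
      obtain ⟨c, hc, hcE, -⟩ := mem_minus_iff.1 hjE'
      exact hjE (hj.le_freeHom_iff.2 (E.lower hc hcE))
  obtain ⟨c, hbc, hcE, hcN⟩ := mem_minus_iff.1 hbE
  obtain ⟨j', hj', rfl⟩ := exists_code_eq hr hcN
  have hj'E : j' ≤ freeHom t E := hj'.le_freeHom_iff.2 hcE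
  have hj'D : ¬ j' ≤ freeHom t D := fun h' =>
    hbD (mem_minus_iff.2 ⟨_, hbc, hj'.le_freeHom_iff.1 h', hcN⟩)
  have hlt := ht.code_lt_code hr hj'.1 (fun e => hjE (by rwa [← e])) (hmax j' hj' (by tauto))
  exact (hb.trans (Pi.toLex_monotone hbc)).not_gt hlt

end freeHom

theorem ParamWord.isRigid_eval {L : Type*} [DistribLattice L] [BoundedOrder L] {r : L → L → Prop}
    (hr : IsNaturalOrder r) {n m : ℕ} (w : ParamWord Unit n m) {h : Fin m → L}
    (hinj : Function.Injective h) (hmem : ∀ x, x ≠ ⊥ ↔ ∃ j, h j = x)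
    (hle : ∀ j j', r (h j) (h j') ↔ j ≤ j') : IsRigid r (eval (fun _ => ⊥) h w) := by
  have := hr.1
  refine ⟨fun x hx => ?_, fun x x' hx hne hxx i hi => ?_⟩
  · obtain ⟨j, rfl⟩ := (hmem x).1 hx
    exact w.exists_eval_eq _ h j
  · have hx' : x' ≠ ⊥ := by
      rintro rfl
      exact hne (antisymm_of r hxx (hr.of_le bot_le))
    obtain ⟨j, rfl⟩ := (hmem x).1 hx
    obtain ⟨j', rfl⟩ := (hmem x').1 hx'
    exact w.exists_lt_eval_eq _ h hinj (fun _ j => ((hmem _).2 ⟨j, rfl⟩).symm) j j'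
      (((hle _ _).1 hxx).lt_of_ne fun e => hne (congrArg h e)) i hi

theorem ParamWord.exists_comp_eq_eval {L K : Type*} [Lattice L] [BoundedOrder L] [Fintype L]
    [Lattice K] [BoundedOrder K] {rL : L → L → Prop} {rK : K → K → Prop}
    (hL : IsNaturalOrder rL) (hK : IsNaturalOrder rK) {m k : ℕ} {a : Fin m → L} {b : Fin k → K}
    (ha : ∀ x, x ≠ ⊥ ↔ ∃ j, a j = x) (hale : ∀ j j', rL (a j) (a j') ↔ j ≤ j')
    (hb : ∀ x, x ≠ ⊥ ↔ ∃ j, b j = x) (hbinj : Function.Injective b)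
    (hble : ∀ j j', rK (b j) (b j') ↔ j ≤ j') {f : L → K} (hf : IsBddLatticeHom f)
    (hs : Function.Surjective f) (hp : IsPositive rL rK f) :
    ∃ u : ParamWord Unit m k, f ∘ a = eval (fun _ => ⊥) b u := by
  have := hL.1
  have hbot (x : L) (j : Fin k) (hx : f x = b j) : x ≠ ⊥ := by
    rintro rfl
    exact (hb (b j)).2 ⟨j, rfl⟩ (hx ▸ hf.2.2.1)
  refine exists_eq_eval _ _ _ hbinj (fun _ j => ((hb _).2 ⟨j, rfl⟩).symm) (fun i => ?_)
    (fun j => ?_) fun j j' hjj i hi => ?_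
  · by_cases h : f (a i) = ⊥
    · exact Or.inl ⟨(), h⟩
    · obtain ⟨j, hj⟩ := (hb _).1 h
      exact Or.inr ⟨j, hj.symm⟩
  · obtain ⟨x, hx⟩ := hs (b j)
    obtain ⟨i, rfl⟩ := (ha x).1 (hbot x j hx)
    exact ⟨i, hx⟩
  · obtain ⟨x, hx, hne, hxj⟩ := hp.exists_lt_map_eq hL hK hf hs (x' := a i) (y := b j)
      (by rw [show f (a i) = _ from hi]; exact (hble _ _).2 hjj.le)
      (fun e => hjj.ne (hbinj (e.trans hi)))
    obtain ⟨i', rfl⟩ := (ha x).1 (hbot x j hxj)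
    exact ⟨i', ((hale _ _).1 hx).lt_of_ne fun e => hne (congrArg a e), hxj⟩

/-- dual Ramsey theorem for naturally ordered finite distributive
lattices: for every `k ≥ 2` and naturally ordered finite distributive lattices
`L_⊑`, `K_≼` admitting a positive surjective homomorphism `L → K`, there is a
naturally ordered finite distributive lattice `N_◁` such that every `k`-coloring
of the positive surjective homomorphisms `N_◁ → K_≼` is constant, with some color
`i`, on `{f ∘ w : f positive surjective}` for some positive surjective
homomorphism `w : N_◁ → L_⊑`. -/
theorem dual_ramsey_naturally_ordered_fdl {L K : Type}
    [DistribLattice L] [Fintype L] [BoundedOrder L]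
    [DistribLattice K] [Fintype K] [BoundedOrder K]
    (rL : L → L → Prop) (rK : K → K → Prop)
    (hL : IsNaturalOrder rL) (hK : IsNaturalOrder rK)
    (k : ℕ) (hk : 2 ≤ k)
    (hex : ∃ f : L → K, IsBddLatticeHom f ∧ Function.Surjective f ∧ IsPositive rL rK f) :
    ∃ (N : FinDistLat) (rN : N.carrier → N.carrier → Prop), IsNaturalOrder rN ∧
      ∀ χ : (N.carrier → K) → Fin k,
        ∃ (i : Fin k) (w : N.carrier → L),
          IsBddLatticeHom w ∧ Function.Surjective w ∧ IsPositive rN rL w ∧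
          ∀ f : L → K, IsBddLatticeHom f → Function.Surjective f → IsPositive rL rK f →
            χ (f ∘ w) = i := by
  obtain ⟨m, a, hainj, ha, hale⟩ := exists_enumeration rL hL.1 (· ≠ ⊥)
  obtain ⟨l, b, hbinj, hb, hble⟩ := exists_enumeration rK hK.1 (· ≠ ⊥)
  obtain ⟨n, hn⟩ := ParamWord.graham_rothschild l Unit (Fin k) m
  have : Fintype (LowerSet (Fin n → Bool)) := Fintype.ofFinite _
  refine ⟨⟨LowerSet (Fin n → Bool)⟩, Antilex toLex,
    isNaturalOrder_antilex toLex.injective Pi.toLex_monotone, fun χ => ?_⟩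
  obtain ⟨w, hw⟩ := hn fun u => χ (freeHom (ParamWord.eval (fun _ => ⊥) b u))
  have hrigid := w.isRigid_eval hL hainj ha hale
  have key (f : L → K) (hf : IsBddLatticeHom f) (hs : Function.Surjective f)
      (hp : IsPositive rL rK f) : ∃ u : ParamWord Unit m l,
        f ∘ freeHom (ParamWord.eval (fun _ => ⊥) a w) =
          freeHom (ParamWord.eval (fun _ => ⊥) b (ParamWord.comp id w u)) := by
    obtain ⟨u, hu⟩ := ParamWord.exists_comp_eq_eval hL hK ha hale hb hbinj hble hf hs hp
    refine ⟨u, ?_⟩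
    rw [comp_freeHom hf, ParamWord.comp_eval, hu, ParamWord.eval_comp]
    congr 2
    funext _
    exact hf.2.2.1
  obtain ⟨f₀, hf₀, hs₀, hp₀⟩ := hex
  refine ⟨χ (f₀ ∘ freeHom (ParamWord.eval (fun _ => ⊥) a w)), freeHom _,
    isBddLatticeHom_freeHom _, hrigid.surjective, hrigid.isPositive hL, fun f hf hs hp => ?_⟩
  obtain ⟨u, hu⟩ := key f hf hs hp
  obtain ⟨u₀, hu₀⟩ := key f₀ hf₀ hs₀ hp₀
  rw [hu, hu₀]
  exact hw u u₀
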